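/- arXiv:2104.12699 — 10 statements merged into one kernel-verified Lean document; each statement's English description precedes it below -/
import Mathlib

section
/- Let T > 0 and φ ∈ ℝ with sin φ ≠ 0, and let g : [0,T] → ℝ be continuous. Define h(t) = −(1/sin φ) ∫₀^T cos(2|t−s| + φ) g(s) ds. Then h is twice continuously differentiable on [0,T], its derivatives are given by h'(t) = (2/sin φ)(∫₀^t sin(2t−2s+φ) g(s) ds − ∫_t^T sin(2s−2t+φ) g(s) ds), and h satisfies the differential equation h''(t) + 4 h(t) = 4 g(t) for all t ∈ [0,T]. -/
open MeasureTheory Real Set intervalIntegral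

theorem integral_cos_sub_mul {G : ℝ → ℝ} (hG : Continuous G) (a b c : ℝ) :
    ∫ s in a..b, Real.cos (2 * s - c) * G s =
      Real.cos c * (∫ s in a..b, Real.cos (2 * s) * G s)
        + Real.sin c * ∫ s in a..b, Real.sin (2 * s) * G s := by
  rw [← intervalIntegral.integral_const_mul, ← intervalIntegral.integral_const_mul,
    ← intervalIntegral.integral_add]
  · refine intervalIntegral.integral_congr fun s _ => ?_
    simp only [Real.cos_sub]
    ring
  all_goals exact Continuous.intervalIntegrable (by fun_prop) _ _

theorem integral_sin_sub_mul {G : ℝ → ℝ} (hG : Continuous G) (a b c : ℝ) :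
    ∫ s in a..b, Real.sin (2 * s - c) * G s =
      Real.cos c * (∫ s in a..b, Real.sin (2 * s) * G s)
        - Real.sin c * ∫ s in a..b, Real.cos (2 * s) * G s := by
  rw [← intervalIntegral.integral_const_mul, ← intervalIntegral.integral_const_mul,
    ← intervalIntegral.integral_sub]
  · refine intervalIntegral.integral_congr fun s _ => ?_
    simp only [Real.sin_sub]
    ring
  all_goals exact Continuous.intervalIntegrable (by fun_prop) _ _

theorem stmt_4 (T φ : ℝ) (hT : 0 < T) (hφ : Real.sin φ ≠ 0)
    (g : ℝ → ℝ) (hg : ContinuousOn g (Icc 0 T))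
    (h h' : ℝ → ℝ)
    (hh : ∀ t, h t = -(1 / Real.sin φ) * ∫ s in (0:ℝ)..T, Real.cos (2 * |t - s| + φ) * g s)
    (hh' : ∀ t, h' t = (2 / Real.sin φ) *
        ((∫ s in (0:ℝ)..t, Real.sin (2*t - 2*s + φ) * g s)
          - ∫ s in t..T, Real.sin (2*s - 2*t + φ) * g s)) :
    (∀ t ∈ Icc (0:ℝ) T, HasDerivWithinAt h (h' t) (Icc 0 T) t) ∧
    (∀ t ∈ Icc (0:ℝ) T, HasDerivWithinAt h' (4 * g t - 4 * h t) (Icc 0 T) t) ∧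
    ContinuousOn (fun t => 4 * g t - 4 * h t) (Icc 0 T) := by
  obtain ⟨G, hG, hgG⟩ : ∃ G : ℝ → ℝ, Continuous G ∧ ∀ t ∈ Icc (0:ℝ) T, g t = G t :=
    ⟨IccExtend hT.le ((Icc 0 T).domRestrict g), hg.domRestrict.Icc_extend',
      fun t ht => by rw [IccExtend_of_mem _ _ ht]; rfl⟩
  have hGc : Continuous fun s => Real.cos (2 * s) * G s := by fun_prop
  have hGs : Continuous fun s => Real.sin (2 * s) * G s := by fun_prop
  set C : ℝ → ℝ := fun t => ∫ s in (0:ℝ)..t, Real.cos (2 * s) * G s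
  set S : ℝ → ℝ := fun t => ∫ s in (0:ℝ)..t, Real.sin (2 * s) * G s
  have dC (t : ℝ) : HasDerivAt C (Real.cos (2 * t) * G t) t :=
    hGc.integral_hasStrictDerivAt 0 t |>.hasDerivAt
  have dS (t : ℝ) : HasDerivAt S (Real.sin (2 * t) * G t) t :=
    hGs.integral_hasStrictDerivAt 0 t |>.hasDerivAt
  have C_sub (t : ℝ) : ∫ s in t..T, Real.cos (2 * s) * G s = C T - C t :=
    (intervalIntegral.integral_interval_sub_left (hGc.intervalIntegrable _ _)
      (hGc.intervalIntegrable _ _)).symm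
  have S_sub (t : ℝ) : ∫ s in t..T, Real.sin (2 * s) * G s = S T - S t :=
    (intervalIntegral.integral_interval_sub_left (hGs.intervalIntegrable _ _)
      (hGs.intervalIntegrable _ _)).symm
  have h_eq : ∀ t ∈ Icc (0:ℝ) T, h t = -(1 / Real.sin φ) *
      (Real.cos (2 * t + φ) * C t + Real.sin (2 * t + φ) * S t
        + (Real.cos (2 * t - φ) * (C T - C t) + Real.sin (2 * t - φ) * (S T - S t))) := by
    intro t ht
    have hI : ∫ s in (0:ℝ)..T, Real.cos (2 * |t - s| + φ) * g s =
        ∫ s in (0:ℝ)..T, Real.cos (2 * |t - s| + φ) * G s := by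
      refine intervalIntegral.integral_congr fun s hs => ?_
      rw [uIcc_of_le hT.le] at hs
      simp only [hgG s hs]
    have hcont : Continuous fun s => Real.cos (2 * |t - s| + φ) * G s := by fun_prop
    rw [hh, hI, ← intervalIntegral.integral_add_adjacent_intervals
      (hcont.intervalIntegrable 0 t) (hcont.intervalIntegrable t T), ← C_sub, ← S_sub,
      ← integral_cos_sub_mul hG, ← integral_cos_sub_mul hG]
    congr 2
    · refine intervalIntegral.integral_congr fun s hs => ?_
      rw [uIcc_of_le ht.1] at hs
      simp only [abs_of_nonneg (sub_nonneg.2 hs.2)]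
      rw [← Real.cos_neg]
      ring_nf
    · refine intervalIntegral.integral_congr fun s hs => ?_
      rw [uIcc_of_le ht.2] at hs
      simp only [abs_of_nonpos (sub_nonpos.2 hs.1)]
      ring_nf
  have h'_eq : ∀ t ∈ Icc (0:ℝ) T, h' t = (2 / Real.sin φ) *
      (-(Real.cos (2 * t + φ) * S t - Real.sin (2 * t + φ) * C t)
        - (Real.cos (2 * t - φ) * (S T - S t) - Real.sin (2 * t - φ) * (C T - C t))) := by
    intro t ht
    rw [hh', ← C_sub, ← S_sub, ← integral_sin_sub_mul hG, ← integral_sin_sub_mul hG,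
      ← intervalIntegral.integral_neg]
    congr 2
    · refine intervalIntegral.integral_congr fun s hs => ?_
      rw [uIcc_of_le ht.1] at hs
      simp only [hgG s ⟨hs.1, hs.2.trans ht.2⟩]
      rw [← neg_mul, ← Real.sin_neg]
      ring_nf
    · refine intervalIntegral.integral_congr fun s hs => ?_
      rw [uIcc_of_le ht.2] at hs
      simp only [hgG s ⟨ht.1.trans hs.1, hs.2⟩]
      ring_nf
  have dlin (c t : ℝ) : HasDerivAt (fun t : ℝ => 2 * t + c) 2 t := by
    simpa using ((hasDerivAt_id t).const_mul 2).add_const c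
  have dlin' (c t : ℝ) : HasDerivAt (fun t : ℝ => 2 * t - c) 2 t := by
    simpa using ((hasDerivAt_id t).const_mul 2).sub_const c
  have hd : ∀ t ∈ Icc (0:ℝ) T, HasDerivWithinAt h (h' t) (Icc 0 T) t := by
    intro t ht
    refine HasDerivWithinAt.congr (HasDerivAt.hasDerivWithinAt ?_) h_eq (h_eq t ht)
    refine (((((dlin φ t).cos.mul (dC t)).add ((dlin φ t).sin.mul (dS t))).add
      (((dlin' φ t).cos.mul ((dC t).const_sub (C T))).add
        ((dlin' φ t).sin.mul ((dS t).const_sub (S T))))).const_mul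
          (-(1 / Real.sin φ))).congr_deriv ?_
    rw [h'_eq t ht]
    simp only [Real.cos_add, Real.sin_add, Real.cos_sub, Real.sin_sub]
    field_simp
    ring
  refine ⟨hd, fun t ht => ?_, ?_⟩
  · refine HasDerivWithinAt.congr (HasDerivAt.hasDerivWithinAt ?_) h'_eq (h'_eq t ht)
    refine (((((dlin φ t).cos.mul (dS t)).sub ((dlin φ t).sin.mul (dC t))).neg.sub
      (((dlin' φ t).cos.mul ((dS t).const_sub (S T))).sub
        ((dlin' φ t).sin.mul ((dC t).const_sub (C T))))).const_mul
          (2 / Real.sin φ)).congr_deriv ?_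
    rw [h_eq t ht, hgG t ht]
    have hsq := Real.sin_sq_add_cos_sq (2 * t)
    simp only [Real.cos_add, Real.sin_add, Real.cos_sub, Real.sin_sub]
    field_simp
    linear_combination (4 * G t * Real.sin φ) * hsq
  · exact (hg.const_smul (4:ℝ)).sub
      (ContinuousOn.const_smul (fun t ht => (hd t ht).continuousWithinAt) (4:ℝ))
end

section
/- For every (φ_W, T) ∈ D₁ ∪ D₃ ∪ D₄, the set {a ∈ ℝ : a > 2 and F¹_{φ_W,T}(a) = 0} is infinite. -/
open Real Set

lemma exists_nat_lt_add_div (B c : ℝ) {T : ℝ} (hT : 0 < T) :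
    ∃ n : ℕ, B < (c + n * (2 * π)) / T := by
  obtain ⟨n, hn⟩ := exists_nat_gt ((B * T - c) / (2 * π))
  refine ⟨n, ?_⟩
  rw [div_lt_iff₀ (by positivity)] at hn
  rw [lt_div_iff₀ hT]
  linarith

lemma exists_gt_root_of_sin_eq_zero (B : ℝ) {θ T : ℝ} (hT : 0 < T) (hs : sin θ = 0) :
    ∃ a, B < a ∧ -4*a - a^2 * sin (a*T) * sin θ - 4 * sin (a*T) * sin θ
      + 4*a * cos (a*T) * cos θ = 0 := by
  rcases sin_eq_zero_iff_cos_eq.1 hs with hc | hc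
  · obtain ⟨n, hn⟩ := exists_nat_lt_add_div B 0 hT
    refine ⟨_, hn, ?_⟩
    rw [div_mul_cancel₀ _ hT.ne', cos_add_nat_mul_two_pi, cos_zero, hs, hc]
    ring
  · obtain ⟨n, hn⟩ := exists_nat_lt_add_div B π hT
    refine ⟨_, hn, ?_⟩
    rw [div_mul_cancel₀ _ hT.ne', cos_add_nat_mul_two_pi, cos_pi, hs, hc]
    ring

lemma exists_gt_root_of_sin_ne_zero (B : ℝ) {θ T : ℝ} (hT : 0 < T) (hs : sin θ ≠ 0) :
    ∃ a, B < a ∧ -4*a - a^2 * sin (a*T) * sin θ - 4 * sin (a*T) * sin θ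
      + 4*a * cos (a*T) * cos θ = 0 := by
  set f : ℝ → ℝ := fun a => -4*a - a^2 * sin (a*T) * sin θ - 4 * sin (a*T) * sin θ
      + 4*a * cos (a*T) * cos θ with hf
  have hcont : Continuous f := by fun_prop
  obtain ⟨n, hn⟩ := exists_nat_lt_add_div (max (max B 0) (4 / |sin θ|)) (π / 2) hT
  set x := (π / 2 + n * (2 * π)) / T with hx
  set y := x + π / T with hy
  have hxT : x * T = π / 2 + n * (2 * π) := div_mul_cancel₀ _ hT.ne'
  have hyT : y * T = π / 2 + n * (2 * π) + π := by
    rw [hy, add_mul, hxT, div_mul_cancel₀ _ hT.ne']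
  have hxy : x ≤ y := by
    have : 0 < π / T := by positivity
    linarith
  obtain ⟨⟨hB, h0⟩, h4⟩ : (B < x ∧ 0 < x) ∧ 4 / |sin θ| < x := by
    simpa only [max_lt_iff] using hn
  rw [div_lt_iff₀ (abs_pos.2 hs)] at h4
  have hfx : f x = -4*x - (x^2 + 4) * sin θ := by
    simp only [hf, hxT, sin_add_nat_mul_two_pi, cos_add_nat_mul_two_pi, sin_pi_div_two,
      cos_pi_div_two]
    ring
  have hfy : f y = -4*y + (y^2 + 4) * sin θ := by
    simp only [hf, hyT, sin_add_pi, cos_add_pi, sin_add_nat_mul_two_pi, cos_add_nat_mul_two_pi,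
      sin_pi_div_two, cos_pi_div_two]
    ring
  have h4y : 4 < y * |sin θ| := h4.trans_le (by gcongr)
  have hmem : (0 : ℝ) ∈ uIcc (f x) (f y) := by
    rw [mem_uIcc, hfx, hfy]
    rcases lt_or_gt_of_ne hs with h | h
    · rw [abs_of_neg h] at h4 h4y
      right
      constructor <;> nlinarith
    · rw [abs_of_pos h] at h4 h4y
      left
      constructor <;> nlinarith
  obtain ⟨a, ha, hfa⟩ := intermediate_value_uIcc hcont.continuousOn hmem
  rw [uIcc_of_le hxy] at ha
  exact ⟨a, hB.trans_le ha.1, hfa⟩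

theorem stmt_6 (φW T : ℝ)
    (hD : (0 < T ∧ T < π / 2 ∧ π / 2 ≤ φW ∧ φW < π - T) ∨
          (0 < T ∧ T ≤ π / 2 ∧ π - T < φW ∧ φW ≤ π ∧ (φW, T) ≠ (π, π / 2)) ∨
          (0 < T ∧ T ≤ π / 2 ∧ 0 < φW ∧ φW < π / 2 ∧ φW + T ≠ π / 2)) :
    {a : ℝ | 2 < a ∧
      -4*a - a^2 * Real.sin (a*T) * Real.sin (2*φW) - 4 * Real.sin (a*T) * Real.sin (2*φW)
        + 4*a * Real.cos (a*T) * Real.cos (2*φW) = 0}.Infinite := by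
  have hT : 0 < T := by rcases hD with h | h | h <;> exact h.1
  refine infinite_of_forall_exists_gt fun B => ?_
  obtain ⟨a, ha, hroot⟩ : ∃ a, max 2 B < a ∧ -4*a - a^2 * sin (a*T) * sin (2*φW)
      - 4 * sin (a*T) * sin (2*φW) + 4*a * cos (a*T) * cos (2*φW) = 0 := by
    by_cases hs : sin (2*φW) = 0
    · exact exists_gt_root_of_sin_eq_zero _ hT hs
    · exact exists_gt_root_of_sin_ne_zero _ hT hs
  rw [max_lt_iff] at ha
  exact ⟨a, ⟨ha.1, hroot⟩, ha.2⟩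
end

section
/- Let (φ_W, T) ∈ D₃ with φ_W < π, and set a' = (2π − 2φ_W)/T. Then 0 < a' < 2 and there exists a ∈ (a', 2) with F¹_{φ_W,T}(a) = 0. In particular F¹_{φ_W,T} has a root in the interval (0,2). -/
open Real Set

theorem stmt_7 (φW T : ℝ)
    (hD : 0 < T ∧ T ≤ π / 2 ∧ π - T < φW ∧ φW ≤ π ∧ (φW, T) ≠ (π, π / 2))
    (hφ : φW < π) :
    0 < (2*π - 2*φW) / T ∧ (2*π - 2*φW) / T < 2 ∧
    ∃ a ∈ Ioo ((2*π - 2*φW) / T) 2,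
      -4*a - a^2 * Real.sin (a*T) * Real.sin (2*φW) - 4 * Real.sin (a*T) * Real.sin (2*φW)
        + 4*a * Real.cos (a*T) * Real.cos (2*φW) = 0 := by
  obtain ⟨hT, hT2, h1, -, -⟩ := hD
  have hpos : 0 < (2*π - 2*φW) / T := div_pos (by linarith) hT
  have hlt : (2*π - 2*φW) / T < 2 := by rw [div_lt_iff₀ hT]; linarith
  refine ⟨hpos, hlt, ?_⟩
  have haT : (2*π - 2*φW) / T * T = 2*π - 2*φW := div_mul_cancel₀ _ hT.ne'
  have hsin : Real.sin (2*π - 2*φW) = -Real.sin (2*φW) := Real.sin_two_pi_sub _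
  have hcos : Real.cos (2*π - 2*φW) = Real.cos (2*φW) := Real.cos_two_pi_sub _
  have hs : 0 < Real.sin (2*π - 2*φW) :=
    Real.sin_pos_of_pos_of_lt_pi (by linarith) (by linarith)
  set f : ℝ → ℝ := fun a ↦
    -4*a - a^2 * Real.sin (a*T) * Real.sin (2*φW) - 4 * Real.sin (a*T) * Real.sin (2*φW)
        + 4*a * Real.cos (a*T) * Real.cos (2*φW) with hf
  have hcont : Continuous f := by fun_prop
  have hleft : 0 < f ((2*π - 2*φW) / T) := by
    have key : f ((2*π - 2*φW) / T) =
        (2 - (2*π - 2*φW) / T)^2 * Real.sin (2*π - 2*φW)^2 := by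
      simp only [hf]
      rw [haT, hsin, hcos]
      linear_combination (4 * ((2*π - 2*φW) / T)) * Real.sin_sq_add_cos_sq (2*φW)
    rw [key]
    have : 0 < 2 - (2*π - 2*φW) / T := sub_pos.2 hlt
    positivity
  have hright : f 2 < 0 := by
    have key : f 2 = 8 * (Real.cos (2*T - (2*π - 2*φW)) - 1) := by
      simp only [hf]
      rw [Real.cos_sub, hsin, hcos]
      ring
    have hc : Real.cos (2*T - (2*π - 2*φW)) < Real.cos 0 :=
      Real.cos_lt_cos_of_nonneg_of_le_pi le_rfl (by linarith) (by linarith)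
    rw [Real.cos_zero] at hc
    linarith
  exact intermediate_value_Ioo' hlt.le hcont.continuousOn ⟨hright, hleft⟩
end

section
/- For every (φ_W, T) ∈ D₁ and every a ∈ (0,2), one has F¹_{φ_W,T}(a) < 0. In particular F¹_{φ_W,T} has no roots in the interval (0,2). -/
open Real Set

/-- On `(0, π / 2)` one has `tan (b T) < b tan T` for `0 < b < 1`, stated without division. -/
theorem sin_mul_cos_lt_mul_sin_cos {b T : ℝ} (hb : 0 < b) (hb1 : b < 1) (hT : 0 < T)
    (hT2 : T < π / 2) :
    Real.sin (b * T) * Real.cos T < b * (Real.sin T * Real.cos (b * T)) := by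
  have hv : 0 < T + b * T := by positivity
  have hvπ : T + b * T ≤ π := by nlinarith
  have hw : 0 < (1 - b) / (1 + b) := div_pos (by linarith) (by linarith)
  have hw' : 0 < 2 * b / (1 + b) := by positivity
  have h := strictConcaveOn_sin_Icc.2 (x := T + b * T) (y := 0) ⟨hv.le, hvπ⟩
    ⟨le_rfl, pi_pos.le⟩ hv.ne' hw hw' (by field_simp; ring)
  simp only [smul_eq_mul, Real.sin_zero, mul_zero, add_zero] at h
  have e : (1 - b) / (1 + b) * (T + b * T) = T - b * T := by field_simp
  rw [e, div_mul_eq_mul_div, div_lt_iff₀ (by linarith), Real.sin_add, Real.sin_sub] at h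
  linarith

theorem stmt_8 (φW T : ℝ)
    (hD : 0 < T ∧ T < π / 2 ∧ π / 2 ≤ φW ∧ φW < π - T)
    (a : ℝ) (ha : a ∈ Ioo (0:ℝ) 2) :
    -4*a - a^2 * Real.sin (a*T) * Real.sin (2*φW) - 4 * Real.sin (a*T) * Real.sin (2*φW)
      + 4*a * Real.cos (a*T) * Real.cos (2*φW) < 0 := by
  obtain ⟨hT, hT2, hφ, hφT⟩ := hD
  obtain ⟨ha0, ha2⟩ := ha
  obtain ⟨b, rfl⟩ : ∃ b, a = 2 * b := ⟨a / 2, by ring⟩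
  obtain ⟨ψ, rfl⟩ : ∃ ψ, φW = π - ψ := ⟨π - φW, by ring⟩
  have hb : 0 < b := by linarith
  have hb1 : b < 1 := by linarith
  have hbT : 0 < b * T := mul_pos hb hT
  have hbT2 : b * T < π / 2 := by nlinarith
  have key := sin_mul_cos_lt_mul_sin_cos hb hb1 hT hT2
  have hS : 0 < Real.sin (b * T) := Real.sin_pos_of_pos_of_lt_pi hbT (by linarith)
  have hC : 0 < Real.cos (b * T) := Real.cos_pos_of_mem_Ioo ⟨by linarith, hbT2⟩
  have hs : Real.sin T ≤ Real.sin ψ :=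
    Real.sin_le_sin_of_le_of_le_pi_div_two (by linarith) (by linarith) (by linarith)
  have hc : Real.cos ψ ≤ Real.cos T :=
    Real.cos_le_cos_of_nonneg_of_le_pi hT.le (by linarith) (by linarith)
  have hc0 : 0 ≤ Real.cos ψ := Real.cos_nonneg_of_mem_Icc ⟨by linarith, by linarith⟩
  have e1 : 2 * b * T = 2 * (b * T) := by ring
  have e2 : 2 * (π - ψ) = 2 * π - 2 * ψ := by ring
  rw [e1, e2, Real.sin_two_pi_sub, Real.cos_two_pi_sub, Real.sin_two_mul, Real.sin_two_mul,
    Real.cos_two_mul, Real.cos_two_mul]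
  have hS2 := Real.sin_sq_add_cos_sq (b * T)
  have hs2 := Real.sin_sq_add_cos_sq ψ
  generalize Real.sin (b * T) = S at *
  generalize Real.cos (b * T) = C at *
  have h1 : S * Real.cos ψ < b * (Real.sin ψ * C) :=
    calc S * Real.cos ψ ≤ S * Real.cos T := by gcongr
      _ < b * (Real.sin T * C) := key
      _ ≤ b * (Real.sin ψ * C) := by gcongr
  generalize Real.sin ψ = s at *
  generalize Real.cos ψ = c at *
  have hY : 0 ≤ S * c := by positivity
  have h2 : b * (S * c) < s * C := by
    have hbb : b * (b * (S * c)) ≤ S * c := by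
      nlinarith [mul_nonneg hY (by nlinarith : 0 ≤ 1 - b * b)]
    exact lt_of_mul_lt_mul_left (hbb.trans_lt h1) hb.le
  have h3 := mul_pos (sub_pos.2 h1) (sub_pos.2 h2)
  linear_combination 16 * h3 + 16 * b * C ^ 2 * hs2 + 16 * b * c ^ 2 * hS2
end

section
/- Fix a ∈ (0,2) and define H₁(x) = −4a + (a² + 4) sin(ax) sin(2x) + 4a cos(ax) cos(2x) for x ∈ [0, π/2]. Then H₁ is strictly decreasing on [0, π/2], and consequently (since H₁(0) = 0) H₁(x) < 0 for all x ∈ (0, π/2]. -/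
open Real Set

/-- The function `a cos (a x) sin (2 x) - 2 sin (a x) cos (2 x)` vanishes at `0` and has derivative
`(4 - a²) sin (a x) sin (2 x)`, so it is positive on `(0, π / 2]`. -/
theorem two_mul_sin_mul_cos_lt_mul_cos_mul_sin {a x : ℝ} (ha : a ∈ Ioo (0:ℝ) 2)
    (hx : x ∈ Ioc (0:ℝ) (π/2)) :
    2 * Real.sin (a*x) * Real.cos (2*x) < a * Real.cos (a*x) * Real.sin (2*x) := by
  obtain ⟨ha0, ha2⟩ := ha
  have hmono : StrictMonoOn (fun y : ℝ =>
      a * Real.cos (a*y) * Real.sin (2*y) - 2 * Real.sin (a*y) * Real.cos (2*y))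
      (Icc 0 (π/2)) := by
    apply strictMonoOn_of_deriv_pos (convex_Icc _ _) (by fun_prop)
    intro y hy
    rw [interior_Icc] at hy
    obtain ⟨hy0, hy1⟩ := hy
    have hsa := ((hasDerivAt_id' y).const_mul a).sin
    have hca := ((hasDerivAt_id' y).const_mul a).cos
    have hs := ((hasDerivAt_id' y).const_mul 2).sin
    have hc := ((hasDerivAt_id' y).const_mul 2).cos
    have hderiv := ((hca.const_mul a).mul hs).sub ((hsa.const_mul 2).mul hc)
    have hpos : 0 < (4 - a^2) * (Real.sin (a*y) * Real.sin (2*y)) := by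
      have h1 : 0 < Real.sin (a*y) :=
        Real.sin_pos_of_pos_of_lt_pi (by positivity) (by nlinarith)
      have h2 : 0 < Real.sin (2*y) :=
        Real.sin_pos_of_pos_of_lt_pi (by positivity) (by linarith)
      have h3 : 0 < 4 - a^2 := by nlinarith
      positivity
    refine hpos.trans_eq (Eq.trans ?_ hderiv.deriv.symm)
    ring
  have h := hmono ⟨le_rfl, by positivity⟩ ⟨hx.1.le, hx.2⟩ hx.1
  simp only [mul_zero, Real.sin_zero, zero_mul, sub_zero] at h
  linarith

theorem stmt_9 (a : ℝ) (ha : a ∈ Ioo (0:ℝ) 2) :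
    StrictAntiOn (fun x : ℝ =>
        -4*a + (a^2 + 4) * Real.sin (a*x) * Real.sin (2*x) + 4*a * Real.cos (a*x) * Real.cos (2*x))
      (Icc 0 (π/2)) ∧
    ∀ x ∈ Ioc (0:ℝ) (π/2),
      -4*a + (a^2 + 4) * Real.sin (a*x) * Real.sin (2*x)
        + 4*a * Real.cos (a*x) * Real.cos (2*x) < 0 := by
  have hanti : StrictAntiOn (fun x : ℝ =>
      -4*a + (a^2 + 4) * Real.sin (a*x) * Real.sin (2*x) + 4*a * Real.cos (a*x) * Real.cos (2*x))
      (Icc 0 (π/2)) := by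
    apply strictAntiOn_of_deriv_neg (convex_Icc _ _) (by fun_prop)
    intro y hy
    rw [interior_Icc] at hy
    have hsa := ((hasDerivAt_id' y).const_mul a).sin
    have hca := ((hasDerivAt_id' y).const_mul a).cos
    have hs := ((hasDerivAt_id' y).const_mul 2).sin
    have hc := ((hasDerivAt_id' y).const_mul 2).cos
    have hderiv := (((hsa.const_mul (a^2 + 4)).mul hs).const_add (-4*a)).add
      ((hca.const_mul (4*a)).mul hc)
    have hneg : (a^2 - 4) * (a * Real.cos (a*y) * Real.sin (2*y)
        - 2 * Real.sin (a*y) * Real.cos (2*y)) < 0 :=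
      mul_neg_of_neg_of_pos (by nlinarith [ha.1, ha.2])
        (sub_pos.2 (two_mul_sin_mul_cos_lt_mul_cos_mul_sin ha ⟨hy.1, hy.2.le⟩))
    refine (hderiv.deriv.trans ?_).trans_lt hneg
    ring
  refine ⟨hanti, fun x hx => ?_⟩
  have h := hanti ⟨le_rfl, by positivity⟩ ⟨hx.1.le, hx.2⟩ hx.1
  simp only [mul_zero, Real.sin_zero, Real.cos_zero] at h
  linarith
end

section
/- For every (φ_W, T) ∈ D₁, one has sin φ_W + T cos φ_W > 0; consequently the determinant Δ = −2 sin φ_W (sin φ_W + T cos φ_W) is strictly negative. -/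
open Real Set

theorem stmt_11 (φW T : ℝ)
    (hD : 0 < T ∧ T < π / 2 ∧ π / 2 ≤ φW ∧ φW < π - T) :
    Real.sin φW + T * Real.cos φW > 0 ∧
    -2 * Real.sin φW * (Real.sin φW + T * Real.cos φW) < 0 := by
  obtain ⟨hT, -, hφ, hφT⟩ := hD
  have hsin : 0 < Real.sin φW := Real.sin_pos_of_pos_of_lt_pi (by linarith [Real.pi_pos]) (by linarith)
  have hpos : 0 < Real.sin φW + T * Real.cos φW := by
    rcases hφ.eq_or_lt with rfl | hlt
    · simp
    · have hcos : 0 < Real.cos (π - φW) :=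
        Real.cos_pos_of_mem_Ioo ⟨by linarith, by linarith⟩
      have htan : T < Real.tan (π - φW) :=
        (show T < π - φW by linarith).trans (Real.lt_tan (by linarith) (by linarith))
      rw [Real.tan_eq_sin_div_cos, lt_div_iff₀ hcos, Real.cos_pi_sub, Real.sin_pi_sub] at htan
      linarith
  exact ⟨hpos, by linarith [mul_pos hsin hpos]⟩
end

section
/- Let φ_W = π and 0 < T < π/2, and set φ = −π − T (so sin φ = sin T ≠ 0). Then μ = 1 is an eigenvalue of the integral operator K with kernel K(t,s) = −cos(2|t−s|+φ)/sin φ: there exist real numbers b, c, not both zero, such that the function g(t) = c·t + b satisfies −(1/sin φ) ∫₀^T cos(2|t−s| + φ) (c·s + b) ds = c·t + b for every t ∈ [0,T]. -/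
open Real Set intervalIntegral

/-- On `[0, T]` the kernel `cos (2|t - s| + φ)` integrates to
`(sin (2t + φ) + sin (2(T - t) + φ)) / 2 - sin φ`. -/
theorem integral_cos_two_mul_abs_sub_add (T φ t : ℝ) (ht : t ∈ Icc (0 : ℝ) T) :
    ∫ s in (0 : ℝ)..T, Real.cos (2 * |t - s| + φ)
      = (Real.sin (2 * t + φ) + Real.sin (2 * (T - t) + φ)) / 2 - Real.sin φ := by
  have hcont : Continuous fun s : ℝ => Real.cos (2 * |t - s| + φ) := by fun_prop
  rw [← integral_add_adjacent_intervals (hcont.intervalIntegrable 0 t)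
    (hcont.intervalIntegrable t T)]
  have left : ∫ s in (0 : ℝ)..t, Real.cos (2 * |t - s| + φ)
      = (Real.sin (2 * t + φ) - Real.sin φ) / 2 := by
    rw [integral_eq_sub_of_hasDerivAt (f := fun s => -Real.sin (2 * (t - s) + φ) / 2) _
      (hcont.intervalIntegrable 0 t)]
    · simp only [sub_self, sub_zero, mul_zero, zero_add]
      ring
    · intro s hs
      rw [uIcc_of_le ht.1] at hs
      rw [abs_of_nonneg (sub_nonneg.2 hs.2)]
      have h := ((((hasDerivAt_id s).const_sub t).const_mul 2).add_const φ).sin.neg.div_const 2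
      exact h.congr_deriv (by simp only [id]; ring)
  have right : ∫ s in t..T, Real.cos (2 * |t - s| + φ)
      = (Real.sin (2 * (T - t) + φ) - Real.sin φ) / 2 := by
    rw [integral_eq_sub_of_hasDerivAt (f := fun s => Real.sin (2 * (s - t) + φ) / 2) _
      (hcont.intervalIntegrable t T)]
    · simp only [sub_self, mul_zero, zero_add]
      ring
    · intro s hs
      rw [uIcc_of_le ht.2] at hs
      rw [abs_sub_comm, abs_of_nonneg (sub_nonneg.2 hs.1)]
      have h := ((((hasDerivAt_id s).sub_const t).const_mul 2).add_const φ).sin.div_const 2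
      exact h.congr_deriv (by simp only [id]; ring)
  rw [left, right]
  ring

theorem stmt_13 (T : ℝ) (hT : 0 < T) (hT' : T < π / 2) :
    ∃ b c : ℝ, (b ≠ 0 ∨ c ≠ 0) ∧
      ∀ t ∈ Icc (0:ℝ) T,
        -(1 / Real.sin (-π - T)) * ∫ s in (0:ℝ)..T,
            Real.cos (2 * |t - s| + (-π - T)) * (c * s + b)
          = c * t + b := by
  refine ⟨1, 0, Or.inl one_ne_zero, fun t ht => ?_⟩
  have hsin : Real.sin (-π - T) = Real.sin T := by
    rw [show -π - T = -(T + π) by ring, Real.sin_neg, Real.sin_add_pi, neg_neg]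
  have hne : Real.sin T ≠ 0 := (Real.sin_pos_of_pos_of_lt_pi hT (by linarith)).ne'
  have hleft : Real.sin (2 * t + (-π - T)) = -Real.sin (2 * t - T) := by
    rw [show 2 * t + (-π - T) = 2 * t - T - π by ring, Real.sin_sub_pi]
  have hright : Real.sin (2 * (T - t) + (-π - T)) = Real.sin (2 * t - T) := by
    rw [show 2 * (T - t) + (-π - T) = -(2 * t - T + π) by ring, Real.sin_neg,
      Real.sin_add_pi, neg_neg]
  simp only [zero_mul, zero_add, mul_one]
  rw [integral_cos_two_mul_abs_sub_add T _ t ht, hleft, hright, hsin]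
  field_simp
  ring
end

section
/- For every (φ_W, T) ∈ D₄, the function F²_{φ_W,T} has at least one positive root: there exists a > 0 such that F²_{φ_W,T}(a) = 0. -/
open Real Set

theorem stmt_14 (φW T : ℝ)
    (hD : 0 < T ∧ T ≤ π / 2 ∧ 0 < φW ∧ φW < π / 2 ∧ φW + T ≠ π / 2) :
    ∃ a : ℝ, 0 < a ∧
      8*a - 2*a^2 * Real.sinh (a*T) * Real.sin (2*φW)
        - 8*a * Real.cosh (a*T) * Real.cos (2*φW)
        + 8 * Real.sinh (a*T) * Real.sin (2*φW) = 0 := by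
  obtain ⟨hT, -, h0, h1, -⟩ := hD
  have hs : 0 < sin (2*φW) := sin_pos_of_pos_of_lt_pi (by linarith) (by linarith)
  have hc1 : cos (2*φW) < 1 := by
    nlinarith [sin_sq_add_cos_sq (2*φW), cos_le_one (2*φW)]
  have hcneg := neg_one_le_cos (2*φW)
  have hs1 := sin_le_one (2*φW)
  generalize sin (2*φW) = s at *
  generalize cos (2*φW) = c at *
  -- The function is positive at some small `a`.
  obtain ⟨a, ha0, ha2, hca⟩ : ∃ a : ℝ, 0 < a ∧ a < 2 ∧ cosh (a*T) * c < 1 := by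
    have hcont : Continuous fun a : ℝ => cosh (a*T) * c := by fun_prop
    have hev : ∀ᶠ a in nhdsWithin (0 : ℝ) (Ioi 0), cosh (a*T) * c < 1 :=
      nhdsWithin_le_nhds (hcont.continuousAt.eventually_lt_const (by simpa using hc1))
    obtain ⟨a, ha, hmem⟩ := (hev.and (Ioo_mem_nhdsGT (zero_lt_two' ℝ))).exists
    exact ⟨a, hmem.1, hmem.2, ha⟩
  -- The function is negative at some large `b`.
  obtain ⟨b, hb2, hbs, hbT⟩ : ∃ b : ℝ, 2 ≤ b ∧ 16 ≤ b * s ∧ 2 ≤ b * T := by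
    refine ⟨max 2 (max (16 / s) (2 / T)), le_max_left _ _, ?_, ?_⟩
    · rw [← div_le_iff₀ hs]; simp
    · rw [← div_le_iff₀ hT]; simp
  let F : ℝ → ℝ := fun a =>
    8*a - 2*a^2 * sinh (a*T) * s - 8*a * cosh (a*T) * c + 8 * sinh (a*T) * s
  have hFa : 0 ≤ F a := by
    have hS : 0 < sinh (a*T) := sinh_pos_iff.2 (by positivity)
    have h₁ : 0 ≤ a * (1 - cosh (a*T) * c) := mul_nonneg ha0.le (by linarith)
    have h₂ : 0 ≤ sinh (a*T) * s * (4 - a^2) :=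
      mul_nonneg (by positivity) (by nlinarith)
    simp only [F]
    linarith
  have hFb : F b ≤ 0 := by
    have hS : b * T ≤ sinh (b*T) := self_le_sinh_iff.2 (by linarith)
    have hC : cosh (b*T) ≤ sinh (b*T) + 1 := by
      have := cosh_sub_sinh (b*T)
      have : exp (-(b*T)) ≤ 1 := exp_le_one_iff.2 (by linarith)
      linarith
    have hCpos := cosh_pos (b*T)
    simp only [F]
    generalize sinh (b*T) = S at *
    generalize cosh (b*T) = C at *
    have h₁ : 0 ≤ b * C * (1 + c) := mul_nonneg (by positivity) (by linarith)
    have h₂ : b * C ≤ b * (S + 1) := by gcongr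
    have h₃ : 0 ≤ S * b * (b * s - 16) :=
      mul_nonneg (mul_nonneg (by linarith) (by linarith)) (by linarith)
    have h₄ : S * s ≤ S * b := mul_le_mul_of_nonneg_left (by linarith) (by linarith)
    have h₅ : 0 ≤ b * (S - 2) := mul_nonneg (by linarith) (by linarith)
    nlinarith
  have hF : ContinuousOn F (Icc a b) := by
    simp only [F]
    fun_prop
  obtain ⟨x, hx, hFx⟩ := intermediate_value_Icc' (by linarith) hF ⟨hFb, hFa⟩
  exact ⟨x, ha0.trans_le hx.1, hFx⟩
end

section
/- For every (φ_W, T) ∈ D₁, the function F²_{φ_W,T} has no positive roots: F²_{φ_W,T}(a) ≠ 0 for all a > 0. -/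
open Real Set

/-- For nonnegative `x`, the hyperbolic tangent is at most `x`, in product form. -/
lemma sinh_le_self_mul_cosh {x : ℝ} (hx : 0 ≤ x) : Real.sinh x ≤ x * Real.cosh x := by
  have hd : ∀ y : ℝ, HasDerivAt (fun y => y * Real.cosh y - Real.sinh y) (y * Real.sinh y) y := by
    intro y
    have h := ((hasDerivAt_id' y).mul (Real.hasDerivAt_cosh y)).sub (Real.hasDerivAt_sinh y)
    exact h.congr_deriv (by ring)
  have hmono : MonotoneOn (fun y => y * Real.cosh y - Real.sinh y) (Ici 0) := by
    refine monotoneOn_of_deriv_nonneg (convex_Ici 0)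
      (fun y _ => (hd y).continuousAt.continuousWithinAt)
      (fun y _ => (hd y).differentiableAt.differentiableWithinAt) fun y hy => ?_
    rw [interior_Ici] at hy
    rw [(hd y).deriv]
    exact mul_nonneg hy.le (Real.sinh_nonneg_iff.2 hy.le)
  have h := hmono (mem_Ici.2 le_rfl) (mem_Ici.2 hx) hx
  simp only [Real.sinh_zero, zero_mul, sub_zero] at h
  linarith

/-- On `0 ≤ T < π / 2`, the inequality `T ≤ tan T` in product form. -/
lemma self_mul_cos_le_sin {T : ℝ} (h0 : 0 ≤ T) (h1 : T < π / 2) : T * Real.cos T ≤ Real.sin T := by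
  have hc : 0 < Real.cos T := Real.cos_pos_of_mem_Ioo ⟨by linarith [Real.pi_pos], h1⟩
  have h := Real.le_tan h0 h1
  rwa [Real.tan_eq_sin_div_cos, le_div_iff₀ hc] at h

/-- Factorization of `F²` through half-angle formulas, with `x = a T / 2`. -/
lemma F_sq_eq_mul (a x φ : ℝ) :
    8*a - 2*a^2 * Real.sinh (2*x) * Real.sin (2*φ)
      - 8*a * Real.cosh (2*x) * Real.cos (2*φ)
      + 8 * Real.sinh (2*x) * Real.sin (2*φ)
    = 8 * (2 * Real.cosh x * Real.sin φ - a * Real.sinh x * Real.cos φ)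
        * (a * Real.cosh x * Real.sin φ + 2 * Real.sinh x * Real.cos φ) := by
  rw [Real.sinh_two_mul, Real.cosh_two_mul, Real.sin_two_mul, Real.cos_two_mul']
  have h : (Real.cosh x ^ 2 - Real.sinh x ^ 2) * (Real.sin φ ^ 2 + Real.cos φ ^ 2) = 1 := by
    rw [Real.cosh_sq_sub_sinh_sq, Real.sin_sq_add_cos_sq, one_mul]
  linear_combination (-8 * a) * h

theorem stmt_15 (φW T : ℝ)
    (hD : 0 < T ∧ T < π / 2 ∧ π / 2 ≤ φW ∧ φW < π - T)
    (a : ℝ) (ha : 0 < a) :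
    8*a - 2*a^2 * Real.sinh (a*T) * Real.sin (2*φW)
      - 8*a * Real.cosh (a*T) * Real.cos (2*φW)
      + 8 * Real.sinh (a*T) * Real.sin (2*φW) ≠ 0 := by
  obtain ⟨hT0, hT1, hφ0, hφ1⟩ := hD
  have hx : 0 < a * T / 2 := by positivity
  rw [show a * T = 2 * (a * T / 2) by ring, F_sq_eq_mul]
  have hch := Real.cosh_pos (a * T / 2)
  have hsh : 0 < Real.sinh (a * T / 2) := Real.sinh_pos_iff.2 hx
  have hs : 0 < Real.sin φW := Real.sin_pos_of_pos_of_lt_pi (by linarith) (by linarith)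
  have hc : 0 ≤ -Real.cos φW :=
    neg_nonneg.2 (Real.cos_nonpos_of_pi_div_two_le_of_le hφ0 (by linarith))
  have hcT : 0 < Real.cos T := Real.cos_pos_of_mem_Ioo ⟨by linarith, hT1⟩
  have hadd : 0 < Real.sin (φW + T) :=
    Real.sin_pos_of_pos_of_lt_pi (by linarith) (by linarith)
  rw [Real.sin_add] at hadd
  have hlt : T * -Real.cos φW < Real.sin φW := by
    refine lt_of_mul_lt_mul_right ?_ hcT.le
    linarith [mul_le_mul_of_nonneg_left (self_mul_cos_le_sin hT0.le hT1) hc]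
  have h1 : 0 < 2 * Real.cosh (a * T / 2) * Real.sin φW
      - a * Real.sinh (a * T / 2) * Real.cos φW := by
    have := mul_nonneg (mul_pos ha hsh).le hc
    have := mul_pos hch hs
    linarith
  have h2 : 0 < a * Real.cosh (a * T / 2) * Real.sin φW
      + 2 * Real.sinh (a * T / 2) * Real.cos φW := by
    have := mul_le_mul_of_nonneg_right (sinh_le_self_mul_cosh hx.le) hc
    have := mul_lt_mul_of_pos_left hlt (mul_pos ha hch)
    linarith
  positivity
end

section
/- Fix a > 0 and define H₂(x) = 8a + (2a² − 8) sinh(ax) sin(2x) − 8a cosh(ax) cos(2x) for x ∈ [0, π/2]. Then H₂ is strictly increasing on [0, π/2], and consequently (since H₂(0) = 0) H₂(x) > 0 for all x ∈ (0, π/2]. -/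
open Real Set

lemma hasDerivAt_cosh_mul_sin_sub_sinh_mul_cos (a x : ℝ) :
    HasDerivAt (fun x : ℝ => a * Real.cosh (a*x) * Real.sin (2*x)
        - 2 * Real.sinh (a*x) * Real.cos (2*x))
      ((a^2 + 4) * (Real.sinh (a*x) * Real.sin (2*x))) x := by
  have h1 : HasDerivAt (fun x : ℝ => a * x) a x := by simpa using (hasDerivAt_id x).const_mul a
  have h2 : HasDerivAt (fun x : ℝ => 2 * x) 2 x := by
    simpa using (hasDerivAt_id x).const_mul (2:ℝ)
  refine (((h1.cosh.const_mul a).mul h2.sin).sub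
    ((h1.sinh.const_mul 2).mul h2.cos)).congr_deriv ?_
  ring

lemma cosh_mul_sin_sub_sinh_mul_cos_pos {a x : ℝ} (ha : 0 < a) (hx : x ∈ Ioo 0 (π/2)) :
    0 < a * Real.cosh (a*x) * Real.sin (2*x) - 2 * Real.sinh (a*x) * Real.cos (2*x) := by
  have hmono : StrictMonoOn (fun x : ℝ => a * Real.cosh (a*x) * Real.sin (2*x)
      - 2 * Real.sinh (a*x) * Real.cos (2*x)) (Icc 0 (π/2)) := by
    refine strictMonoOn_of_deriv_pos (convex_Icc _ _) (by fun_prop) fun y hy => ?_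
    rw [interior_Icc] at hy
    rw [(hasDerivAt_cosh_mul_sin_sub_sinh_mul_cos a y).deriv]
    have h1 : 0 < Real.sinh (a*y) := Real.sinh_pos_iff.2 (mul_pos ha hy.1)
    have h2 : 0 < Real.sin (2*y) :=
      Real.sin_pos_of_pos_of_lt_pi (by linarith [hy.1]) (by linarith [hy.2])
    positivity
  simpa using hmono ⟨le_rfl, by positivity⟩ ⟨hx.1.le, hx.2.le⟩ hx.1

theorem stmt_16 (a : ℝ) (ha : 0 < a) :
    StrictMonoOn (fun x : ℝ =>
        8*a + (2*a^2 - 8) * Real.sinh (a*x) * Real.sin (2*x) - 8*a * Real.cosh (a*x) * Real.cos (2*x))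
      (Icc 0 (π/2)) ∧
    ∀ x ∈ Ioc (0:ℝ) (π/2),
      8*a + (2*a^2 - 8) * Real.sinh (a*x) * Real.sin (2*x)
        - 8*a * Real.cosh (a*x) * Real.cos (2*x) > 0 := by
  have hmono : StrictMonoOn (fun x : ℝ =>
      8*a + (2*a^2 - 8) * Real.sinh (a*x) * Real.sin (2*x)
        - 8*a * Real.cosh (a*x) * Real.cos (2*x)) (Icc 0 (π/2)) := by
    refine strictMonoOn_of_deriv_pos (convex_Icc _ _) (by fun_prop) fun y hy => ?_
    rw [interior_Icc] at hy
    have h1 : HasDerivAt (fun x : ℝ => a * x) a y := by simpa using (hasDerivAt_id y).const_mul a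
    have h2 : HasDerivAt (fun x : ℝ => 2 * x) 2 y := by
      simpa using (hasDerivAt_id y).const_mul (2:ℝ)
    have hderiv : HasDerivAt (fun x : ℝ =>
        8*a + (2*a^2 - 8) * Real.sinh (a*x) * Real.sin (2*x)
          - 8*a * Real.cosh (a*x) * Real.cos (2*x))
        (2 * (a^2 + 4) * (a * Real.cosh (a*y) * Real.sin (2*y)
          - 2 * Real.sinh (a*y) * Real.cos (2*y))) y := by
      refine ((((h1.sinh.const_mul (2*a^2 - 8)).mul h2.sin).const_add (8*a)).sub
        ((h1.cosh.const_mul (8*a)).mul h2.cos)).congr_deriv ?_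
      ring
    rw [hderiv.deriv]
    exact mul_pos (by positivity) (cosh_mul_sin_sub_sinh_mul_cos_pos ha hy)
  refine ⟨hmono, fun x hx => ?_⟩
  simpa using hmono ⟨le_rfl, by positivity⟩ ⟨hx.1.le, hx.2⟩ hx.1
end
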